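/- Let ρ be a law invariant risk measure whose induced divergence α is simplified. Then for every Polish space E and all μ, ν ∈ 𝓟(E), α(ν|μ) = sup{α(ν∘T⁻¹ | μ∘T⁻¹) : T : E → F measurable, F a finite set}. -/

import Mathlib

open MeasureTheory ProbabilityTheory Filter Topology
open scoped ENNReal NNReal

noncomputable section

namespace RiskDiv

/-- A bounded measurable real-valued function (a representative of an element of `L^∞`). -/
def BddMeas {E : Type*} [MeasurableSpace E] (f : E → ℝ) : Prop :=
  Measurable f ∧ ∃ M : ℝ, ∀ x, |f x| ≤ M

/-- A (normalized, convex, monotone, cash-additive) risk measure on `L^∞(E, μ)`,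
viewed as a functional on bounded measurable functions which respects a.e. equality. -/
structure IsRiskMeasure {E : Type*} [MeasurableSpace E] (μ : Measure E)
    (ρ : (E → ℝ) → ℝ) : Prop where
  mono : ∀ f g : E → ℝ, BddMeas f → BddMeas g → (∀ᵐ x ∂μ, f x ≤ g x) → ρ f ≤ ρ g
  cash : ∀ (f : E → ℝ) (c : ℝ), BddMeas f → ρ (fun x => f x + c) = ρ f + c
  norm0 : ρ (fun _ => 0) = 0
  cvx : ∀ (f g : E → ℝ) (t : ℝ), BddMeas f → BddMeas g → 0 ≤ t → t ≤ 1 →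
    ρ (fun x => t * f x + (1 - t) * g x) ≤ t * ρ f + (1 - t) * ρ g
  congr_ae : ∀ f g : E → ℝ, BddMeas f → BddMeas g → (∀ᵐ x ∂μ, f x = g x) → ρ f = ρ g

/-- Law invariance: `ρ` only depends on the distribution of its argument. -/
def LawInvariant {E : Type*} [MeasurableSpace E] (μ : Measure E) (ρ : (E → ℝ) → ℝ) : Prop :=
  ∀ f g : E → ℝ, BddMeas f → BddMeas g → μ.map f = μ.map g → ρ f = ρ g

open Classical in
/-- `ρ_μ(f) := ρ(f ∘ X)` where `X` is any random variable with law `μ` (this is well defined,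
independently of the choice of `X`, when `ρ` is law invariant). -/
def rhoMu {Ω : Type*} [MeasurableSpace Ω] (P : Measure Ω) (ρ : (Ω → ℝ) → ℝ)
    {E : Type*} [MeasurableSpace E] (μ : Measure E) (f : E → ℝ) : ℝ :=
  if h : ∃ X : Ω → E, Measurable X ∧ P.map X = μ then ρ (f ∘ h.choose) else 0

/-- The divergence induced by `ρ`:
`α(ν|μ) := sup { ∫ f dν − ρ_μ(f) : f bounded measurable } ∈ [0,∞]`. -/
def divergence {Ω : Type*} [MeasurableSpace Ω] (P : Measure Ω) (ρ : (Ω → ℝ) → ℝ)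
    {E : Type*} [MeasurableSpace E] (ν μ : Measure E) : ℝ≥0∞ :=
  ⨆ (f : E → ℝ) (_ : BddMeas f), ENNReal.ofReal ((∫ x, f x ∂ν) - rhoMu P ρ μ f)

/-- The divergence induced by `ρ` is simplified if, on `[0,1]`, the supremum defining it can be
restricted to continuous functions. -/
def Simplified {Ω : Type*} [MeasurableSpace Ω] (P : Measure Ω) (ρ : (Ω → ℝ) → ℝ) : Prop :=
  ∀ μ ν : Measure (Set.Icc (0:ℝ) 1), IsProbabilityMeasure μ → IsProbabilityMeasure ν →
    divergence P ρ ν μ =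
      ⨆ (f : (Set.Icc (0:ℝ) 1) → ℝ) (_ : Continuous f),
        ENNReal.ofReal ((∫ x, f x ∂ν) - rhoMu P ρ μ f)

/-- The distribution function of a nonatomic law on the line is continuous. -/
lemma continuous_cdf (Q : Measure ℝ) [IsProbabilityMeasure Q] (h : ∀ x, Q {x} = 0) :
    Continuous (cdf Q) := by
  refine continuous_iff_continuousAt.2 fun a => ?_
  have h1 := (cdf Q).measure_singleton a
  rw [measure_cdf, h a] at h1
  have h2 : cdf Q a - Function.leftLim (cdf Q) a ≤ 0 := by
    simpa using h1.symm
  have h3 : Function.leftLim (cdf Q) a ≤ cdf Q a := (monotone_cdf Q).leftLim_le le_rfl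
  rw [(monotone_cdf Q).continuousAt_iff_leftLim_eq_rightLim, StieltjesFunction.rightLim_eq]
  linarith

lemma measure_cdf_le_of_pos (Q : Measure ℝ) [IsProbabilityMeasure Q] (h : ∀ x, Q {x} = 0)
    (x : ℝ) (h0 : 0 < x) (h1 : x < 1) : Q {y | cdf Q y ≤ x} = ENNReal.ofReal x := by
  have hc := continuous_cdf Q h
  obtain ⟨a, ha⟩ := ((tendsto_cdf_atBot Q).eventually_lt_const h0).exists
  obtain ⟨b, hb⟩ := ((tendsto_cdf_atTop Q).eventually_const_lt h1).exists
  obtain ⟨y, hy⟩ := mem_range_of_exists_le_of_exists_ge hc ⟨a, ha.le⟩ ⟨b, hb.le⟩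
  set S := {y | cdf Q y ≤ x} with hS
  have hcl : IsClosed S := isClosed_le hc continuous_const
  have hbd : BddAbove S := ⟨b, fun z hz => by
    by_contra! hlt
    have := monotone_cdf Q hlt.le
    have hz' : cdf Q z ≤ x := hz
    linarith⟩
  have hyS : y ∈ S := hy.le
  have hmem : sSup S ∈ S := hcl.csSup_mem ⟨y, hyS⟩ hbd
  have hle : cdf Q (sSup S) ≤ x := hmem
  have hge : x ≤ cdf Q (sSup S) := hy ▸ monotone_cdf Q (le_csSup hbd hyS)
  have hSe : S = Set.Iic (sSup S) := by
    ext z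
    exact ⟨fun hz => le_csSup hbd hz, fun hz => (monotone_cdf Q hz).trans hle⟩
  rw [hSe, ← ofReal_cdf, le_antisymm hle hge]

lemma measure_cdf_le (Q : Measure ℝ) [IsProbabilityMeasure Q] (h : ∀ x, Q {x} = 0)
    (x : ℝ) (h0 : 0 ≤ x) (h1 : x ≤ 1) : Q {y | cdf Q y ≤ x} = ENNReal.ofReal x := by
  rcases h1.eq_or_lt with rfl | h1
  · have : {y | cdf Q y ≤ 1} = Set.univ := Set.eq_univ_of_forall fun y => cdf_le_one Q y
    simp [this]
  rcases h0.eq_or_lt with rfl | h0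
  · rw [ENNReal.ofReal_zero]
    refine le_antisymm (ENNReal.le_of_forall_pos_le_add fun ε hε _ => ?_) bot_le
    have hm : (0 : ℝ) < min (ε : ℝ) (1 / 2) := lt_min hε (by norm_num)
    calc Q {y | cdf Q y ≤ 0} ≤ Q {y | cdf Q y ≤ min (ε : ℝ) (1 / 2)} :=
          measure_mono fun y hy => le_trans hy hm.le
      _ = ENNReal.ofReal (min (ε : ℝ) (1 / 2)) :=
          measure_cdf_le_of_pos Q h _ hm ((min_le_right _ _).trans_lt (by norm_num))
      _ ≤ ENNReal.ofReal ε := ENNReal.ofReal_le_ofReal (min_le_left _ _)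
      _ = 0 + ε := by simp
  · exact measure_cdf_le_of_pos Q h x h0 h1

/-- A nonatomic standard Borel probability space carries a uniform random variable. -/
lemma exists_uniform {Ω : Type*} [MeasurableSpace Ω] [StandardBorelSpace Ω]
    (P : Measure Ω) [IsProbabilityMeasure P] [NullSingletonClass P] :
    ∃ U : Ω → unitInterval, Measurable U ∧ P.map U = volume := by
  have he := measurableEmbedding_embeddingReal Ω
  set Q := P.map (embeddingReal Ω) with hQ
  have : IsProbabilityMeasure Q := Measure.isProbabilityMeasure_map he.measurable.aemeasurable
  have hQ0 : ∀ x, Q {x} = 0 := fun x => by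
    rw [hQ, he.map_apply]
    exact (Set.subsingleton_singleton.preimage he.injective).measure_zero P
  let U : Ω → unitInterval := fun ω =>
    ⟨cdf Q (embeddingReal Ω ω), cdf_nonneg Q _, cdf_le_one Q _⟩
  have hU : Measurable U :=
    (((monotone_cdf Q).measurable).comp he.measurable).subtype_mk
  have : IsProbabilityMeasure (P.map U) := Measure.isProbabilityMeasure_map hU.aemeasurable
  refine ⟨U, hU, (P.map U).ext_of_Iic volume fun x => ?_⟩
  rw [Measure.map_apply hU measurableSet_Iic, unitInterval.volume_Iic,
    ← measure_cdf_le Q hQ0 x x.2.1 x.2.2, hQ, he.map_apply]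
  rfl

lemma exists_law {Ω : Type*} [MeasurableSpace Ω] [StandardBorelSpace Ω]
    (P : Measure Ω) [IsProbabilityMeasure P] [NullSingletonClass P]
    {E : Type*} [MeasurableSpace E] [StandardBorelSpace E] (μ : Measure E)
    [IsProbabilityMeasure μ] : ∃ X : Ω → E, Measurable X ∧ P.map X = μ := by
  have : Nonempty E := nonempty_of_isProbabilityMeasure μ
  obtain ⟨U, hU, hUm⟩ := exists_uniform P
  obtain ⟨f, hf, hfm⟩ := μ.exists_measurable_map_eq
  exact ⟨f ∘ U, hf.comp hU, by rw [← Measure.map_map hf hU, hUm, hfm]⟩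

lemma BddMeas.comp {E F : Type*} [MeasurableSpace E] [MeasurableSpace F] {f : F → ℝ}
    (hf : BddMeas f) {X : E → F} (hX : Measurable X) : BddMeas (f ∘ X) :=
  ⟨hf.1.comp hX, hf.2.imp fun _ hM x => hM (X x)⟩

/-- `ρ_μ(f) = ρ(f ∘ X)` for any `X` of law `μ`. -/
lemma rhoMu_eq {Ω : Type*} [MeasurableSpace Ω] {P : Measure Ω} {ρ : (Ω → ℝ) → ℝ}
    (hLI : LawInvariant P ρ) {E : Type*} [MeasurableSpace E] {μ : Measure E} {f : E → ℝ}
    (hf : BddMeas f) {X : Ω → E} (hX : Measurable X) (hXm : P.map X = μ) :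
    rhoMu P ρ μ f = ρ (f ∘ X) := by
  have h : ∃ X : Ω → E, Measurable X ∧ P.map X = μ := ⟨X, hX, hXm⟩
  rw [rhoMu, dif_pos h]
  refine hLI _ _ (hf.comp h.choose_spec.1) (hf.comp hX) ?_
  rw [← Measure.map_map hf.1 hX, ← Measure.map_map hf.1 h.choose_spec.1, hXm, h.choose_spec.2]

/-- Uniform approximation by functions factoring through a finite set. -/
lemma exists_approx {E : Type*} [MeasurableSpace E] {f : E → ℝ} (hf : BddMeas f)
    {ε : ℝ} (hε : 0 < ε) : ∃ (n : ℕ) (T : E → Fin n) (g : Fin n → ℝ), Measurable T ∧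
      ∀ x, g (T x) ≤ f x ∧ f x ≤ g (T x) + ε := by
  obtain ⟨hm, M, hM⟩ := hf
  have hlo : ∀ x, 0 ≤ (f x + M) / ε := fun x =>
    div_nonneg (by linarith [(abs_le.1 (hM x)).1]) hε.le
  have hhi : ∀ x, (f x + M) / ε ≤ 2 * M / ε := fun x => by
    have := (abs_le.1 (hM x)).2
    gcongr
    linarith
  let T : E → Fin (⌊2 * M / ε⌋₊ + 1) := fun x =>
    ⟨⌊(f x + M) / ε⌋₊, Nat.lt_succ_of_le (Nat.floor_mono (hhi x))⟩
  refine ⟨_, T, fun k => (k : ℕ) * ε - M, ?_, fun x => ?_⟩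
  · refine measurable_to_countable' fun k => ?_
    have h1 : Measurable fun x => ⌊(f x + M) / ε⌋₊ :=
      Nat.measurable_floor.comp ((hm.add_const M).div_const ε)
    have h2 : T ⁻¹' {k} = (fun x => ⌊(f x + M) / ε⌋₊) ⁻¹' {(k : ℕ)} := by
      ext x
      simp [T, Fin.ext_iff]
    rw [h2]
    exact h1 (measurableSet_singleton _)
  · have h1 := Nat.floor_le (hlo x)
    have h2 := (Nat.lt_floor_add_one ((f x + M) / ε)).le
    rw [le_div_iff₀ hε] at h1
    rw [div_le_iff₀ hε] at h2
    simp only [T]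
    constructor <;> linarith

/-- A simplified divergence is determined by its values on finite spaces:
`α(ν|μ) = sup {α(ν∘T⁻¹ | μ∘T⁻¹) : T : E → F measurable, F finite}`. -/
theorem statement16 {Ω : Type*} [MeasurableSpace Ω] [StandardBorelSpace Ω]
    (P : Measure Ω) [IsProbabilityMeasure P] [NullSingletonClass P]
    (ρ : (Ω → ℝ) → ℝ) (hρ : IsRiskMeasure P ρ) (hLI : LawInvariant P ρ)
    (hSimp : Simplified P ρ)
    (E : Type) [TopologicalSpace E] [MeasurableSpace E] [PolishSpace E] [BorelSpace E]
    (μ ν : Measure E) [IsProbabilityMeasure μ] [IsProbabilityMeasure ν] :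
    divergence P ρ ν μ =
      ⨆ (n : ℕ) (T : E → Fin n) (_ : Measurable T),
        divergence P ρ (ν.map T) (μ.map T) := by
  obtain ⟨X, hX, hXm⟩ := exists_law P μ
  have key : ∀ (n : ℕ) (T : E → Fin n) (g : Fin n → ℝ), Measurable T → BddMeas g →
      (∫ x, g x ∂(ν.map T)) - rhoMu P ρ (μ.map T) g
        = (∫ x, (g ∘ T) x ∂ν) - rhoMu P ρ μ (g ∘ T) := by
    intro n T g hT hg
    rw [integral_map hT.aemeasurable hg.1.aestronglyMeasurable,
      rhoMu_eq hLI hg (hT.comp hX) (by rw [← Measure.map_map hT hX, hXm]),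
      rhoMu_eq hLI (hg.comp hT) hX hXm]
    rfl
  apply le_antisymm
  · refine iSup₂_le fun f hf => ?_
    refine ENNReal.le_of_forall_pos_le_add fun ε hε _ => ?_
    obtain ⟨n, T, g, hT, hgT⟩ := exists_approx hf (ε := (ε : ℝ)) hε
    have hg : BddMeas g := by
      refine ⟨measurable_of_countable g, ?_⟩
      obtain ⟨M, hM⟩ := (Set.finite_range fun k => |g k|).bddAbove
      exact ⟨M, fun k => hM ⟨k, rfl⟩⟩
    have hint : ∀ h : E → ℝ, BddMeas h → Integrable h ν := fun h hh => by
      obtain ⟨M, hM⟩ := hh.2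
      exact Integrable.of_bound hh.1.aestronglyMeasurable M (ae_of_all _ hM)
    have hgTb := hg.comp hT
    have h1 : ∫ x, f x ∂ν ≤ (∫ x, (g ∘ T) x ∂ν) + ε := by
      have h := integral_mono (hint f hf) ((hint _ hgTb).add (integrable_const (ε : ℝ)))
        fun x => (hgT x).2
      rw [integral_add' (hint _ hgTb) (integrable_const (ε : ℝ))] at h
      simpa using h
    have h2 : rhoMu P ρ μ (g ∘ T) ≤ rhoMu P ρ μ f := by
      rw [rhoMu_eq hLI hgTb hX hXm, rhoMu_eq hLI hf hX hXm]
      exact hρ.mono _ _ (hgTb.comp hX) (hf.comp hX) (ae_of_all _ fun x => (hgT (X x)).1)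
    calc ENNReal.ofReal ((∫ x, f x ∂ν) - rhoMu P ρ μ f)
        ≤ ENNReal.ofReal (((∫ x, g x ∂(ν.map T)) - rhoMu P ρ (μ.map T) g) + ε) := by
          rw [key n T g hT hg]
          exact ENNReal.ofReal_le_ofReal (by linarith)
      _ ≤ ENNReal.ofReal ((∫ x, g x ∂(ν.map T)) - rhoMu P ρ (μ.map T) g)
            + ENNReal.ofReal ε := ENNReal.ofReal_add_le
      _ ≤ _ := by
          rw [ENNReal.ofReal_coe_nnreal]
          gcongr
          refine le_iSup_of_le n (le_iSup₂_of_le T hT ?_)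
          exact le_iSup₂_of_le g hg le_rfl
  · refine iSup_le fun n => iSup₂_le fun T hT => iSup₂_le fun g hg => ?_
    rw [key n T g hT hg]
    exact le_iSup₂_of_le (g ∘ T) (hg.comp hT) le_rfl

end RiskDiv
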